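/- For all x, y ∈ ℝ² one has ‖σ(x) − σ(y)‖² + ⟨x−y, b(x)−b(y)⟩ ≤ 3|x−y|² (the one-sided Lipschitz/monotonicity condition (1.4) of the paper for the example coefficients, with g ≡ 3). -/

import Mathlib

open Real

/-- Euclidean norm of a vector in ℝ². -/
noncomputable def nrm (x : Fin 2 → ℝ) : ℝ := Real.sqrt (x 0 ^ 2 + x 1 ^ 2)

/-- Euclidean inner product on ℝ². -/
noncomputable def inn (x y : Fin 2 → ℝ) : ℝ := x 0 * y 0 + x 1 * y 1

/-- The example diffusion coefficient σ(x). -/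
noncomputable def sig (p : ℝ) (x : Fin 2 → ℝ) : Matrix (Fin 2) (Fin 2) ℝ :=
  ![![x 0 / (1 + nrm x), x 1 / (1 + nrm x)],
    ![-((1 + nrm x ^ (p / 2 - 1)) * x 1), (1 + nrm x ^ (p / 2 - 1)) * x 0]]

/-- The example drift coefficient b(x) = -K₀(1+|x|^{p-2})x. -/
noncomputable def bdrift (p K₀ : ℝ) (x : Fin 2 → ℝ) : Fin 2 → ℝ :=
  fun i => -(K₀ * (1 + nrm x ^ (p - 2))) * x i

/-- Squared Hilbert–Schmidt (Frobenius) norm of a 2×2 real matrix. -/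
noncomputable def hsSq (M : Matrix (Fin 2) (Fin 2) ℝ) : ℝ := ∑ i, ∑ j, M i j ^ 2

theorem rpow_mul_le_rpow_mul {a b q : ℝ} (hb : 0 ≤ b) (hab : b ≤ a) (hq : q ≤ 1) :
    a ^ q * b ≤ b ^ q * a := by
  rcases hb.eq_or_lt with rfl | hb
  · simpa using mul_nonneg (rpow_nonneg le_rfl q) hab
  have ha : 0 < a := hb.trans_le hab
  have h := rpow_le_rpow_of_nonpos hb hab (sub_nonpos.2 hq)
  rw [rpow_sub_one ha.ne', rpow_sub_one hb.ne', div_le_div_iff₀ ha hb] at h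
  exact h

theorem four_mul_sq_rpow_sub_le {a b q : ℝ} (ha : 0 ≤ a) (hb : 0 ≤ b) (hq0 : 0 ≤ q) (hq : q ≤ 1) :
    4 * (a ^ q - b ^ q) ^ 2 * (a * b) ≤ (a ^ q * a - b ^ q * b) ^ 2 := by
  wlog hab : b ≤ a generalizing a b
  · linarith [this hb ha (le_of_not_ge hab)]
  have hmono := rpow_le_rpow hb hab hq0
  have hcross := rpow_mul_le_rpow_mul hb hab hq
  have h : (a ^ q - b ^ q) * (a + b) ≤ a ^ q * a - b ^ q * b := by linarith
  have hsq := pow_le_pow_left₀ (mul_nonneg (sub_nonneg.2 hmono) (add_nonneg ha hb)) h 2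
  nlinarith [sq_nonneg ((a ^ q - b ^ q) * (a - b))]

/-- The radial map `x ↦ |x| ^ (2 * q) • x` is monotone; here `c` stands for `⟨x, y⟩`. -/
theorem radial_monotone {a b c q : ℝ} (ha : 0 ≤ a) (hb : 0 ≤ b) (hc : c ≤ a * b) (hq0 : 0 ≤ q) :
    0 ≤ (a ^ q) ^ 2 * a ^ 2 + (b ^ q) ^ 2 * b ^ 2 - ((a ^ q) ^ 2 + (b ^ q) ^ 2) * c := by
  have h : 0 ≤ ((a ^ q) ^ 2 * a - (b ^ q) ^ 2 * b) * (a - b) := by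
    rcases le_total b a with hab | hab
    · refine mul_nonneg (sub_nonneg.2 ?_) (sub_nonneg.2 hab)
      gcongr
    · refine mul_nonneg_of_nonpos_of_nonpos (sub_nonpos.2 ?_) (sub_nonpos.2 hab)
      gcongr
  have hc' := mul_le_mul_of_nonneg_left hc (add_nonneg (sq_nonneg (a ^ q)) (sq_nonneg (b ^ q)))
  linarith

theorem radial_sq_le_two_mul {a b c q : ℝ} (ha : 0 ≤ a) (hb : 0 ≤ b) (hc : c ≤ a * b)
    (hq0 : 0 ≤ q) (hq : q ≤ 1) :
    (a ^ q) ^ 2 * a ^ 2 + (b ^ q) ^ 2 * b ^ 2 - 2 * (a ^ q * b ^ q) * c ≤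
      2 * ((a ^ q) ^ 2 * a ^ 2 + (b ^ q) ^ 2 * b ^ 2 - ((a ^ q) ^ 2 + (b ^ q) ^ 2) * c) := by
  have h := four_mul_sq_rpow_sub_le ha hb hq0 hq
  have hA := rpow_nonneg ha q
  have hB := rpow_nonneg hb q
  have hcoef : 0 ≤ (a ^ q) ^ 2 + (b ^ q) ^ 2 - a ^ q * b ^ q := by
    nlinarith [sq_nonneg (a ^ q - b ^ q), mul_nonneg hA hB]
  have hc' := mul_le_mul_of_nonneg_left hc hcoef
  nlinarith [mul_nonneg (sq_nonneg (a ^ q - b ^ q)) (mul_nonneg ha hb)]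

/-- The map `x ↦ x / (1 + |x|)` is nonexpansive; here `c` stands for `⟨x, y⟩`. -/
theorem radial_div_nonexpansive {a b c : ℝ} (ha : 0 ≤ a) (hb : 0 ≤ b) (hc : c ≤ a * b) :
    a ^ 2 * (1 + a)⁻¹ ^ 2 + b ^ 2 * (1 + b)⁻¹ ^ 2 - 2 * ((1 + a)⁻¹ * (1 + b)⁻¹) * c ≤
      a ^ 2 + b ^ 2 - 2 * c := by
  have hu : (1 + a)⁻¹ ≤ 1 := inv_le_one_of_one_le₀ (by linarith)
  have hv : (1 + b)⁻¹ ≤ 1 := inv_le_one_of_one_le₀ (by linarith)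
  have hu0 : 0 ≤ (1 + a)⁻¹ := by positivity
  have hv0 : 0 ≤ (1 + b)⁻¹ := by positivity
  have huv : (1 + a)⁻¹ * (1 + b)⁻¹ ≤ 1 := mul_le_one₀ hu hv0 hv
  have hdiff : a * (1 + a)⁻¹ - b * (1 + b)⁻¹ = (a - b) * ((1 + a)⁻¹ * (1 + b)⁻¹) := by
    field_simp
    ring
  have hsq : (a * (1 + a)⁻¹ - b * (1 + b)⁻¹) ^ 2 ≤ (a - b) ^ 2 := by
    rw [hdiff, mul_pow]
    exact mul_le_of_le_one_right (sq_nonneg _) (pow_le_one₀ (mul_nonneg hu0 hv0) huv)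
  have hc' := mul_le_mul_of_nonneg_left hc (sub_nonneg.2 huv)
  linarith

theorem nrm_nonneg (x : Fin 2 → ℝ) : 0 ≤ nrm x := sqrt_nonneg _

theorem nrm_sq (x : Fin 2 → ℝ) : nrm x ^ 2 = x 0 ^ 2 + x 1 ^ 2 := sq_sqrt (by positivity)

theorem inn_le_nrm_mul_nrm (x y : Fin 2 → ℝ) : inn x y ≤ nrm x * nrm y := by
  refine (abs_le_of_sq_le_sq' ?_ (mul_nonneg (nrm_nonneg x) (nrm_nonneg y))).2
  rw [mul_pow, nrm_sq, nrm_sq, inn]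
  linarith [sq_nonneg (x 0 * y 1 - x 1 * y 0)]

theorem hsSq_sig_sub (p : ℝ) (x y : Fin 2 → ℝ) :
    hsSq (sig p x - sig p y) =
      (x 0 * (1 + nrm x)⁻¹ - y 0 * (1 + nrm y)⁻¹) ^ 2 +
        (x 1 * (1 + nrm x)⁻¹ - y 1 * (1 + nrm y)⁻¹) ^ 2 +
      ((-((1 + nrm x ^ (p / 2 - 1)) * x 1) - -((1 + nrm y ^ (p / 2 - 1)) * y 1)) ^ 2 +
        ((1 + nrm x ^ (p / 2 - 1)) * x 0 - (1 + nrm y ^ (p / 2 - 1)) * y 0) ^ 2) := by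
  simp only [hsSq, Fin.sum_univ_two, Matrix.sub_apply]
  rfl

/-- One-sided Lipschitz/monotonicity condition (1.4) for the example coefficients:
‖σ(x) − σ(y)‖² + ⟨x−y, b(x)−b(y)⟩ ≤ 3|x−y|². -/
theorem stmt10 (p K₀ : ℝ) (hp2 : 2 < p) (hp4 : p < 4) (hK₀ : 4 ≤ K₀)
    (x y : Fin 2 → ℝ) :
    hsSq (sig p x - sig p y) + inn (x - y) (bdrift p K₀ x - bdrift p K₀ y)
      ≤ 3 * nrm (x - y) ^ 2 := by
  have ha := nrm_nonneg x
  have hb := nrm_nonneg y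
  have ha2 := nrm_sq x
  have hb2 := nrm_sq y
  have hc := inn_le_nrm_mul_nrm x y
  have hq0 : 0 ≤ p / 2 - 1 := by linarith
  have hq1 : p / 2 - 1 ≤ 1 := by linarith
  have hpow : ∀ r : ℝ, 0 ≤ r → r ^ (p - 2) = (r ^ (p / 2 - 1)) ^ 2 := fun r hr => by
    rw [← rpow_mul_natCast hr]
    congr 1
    push_cast
    ring
  have hmono := radial_monotone ha hb hc hq0
  have hgrowth := radial_sq_le_two_mul ha hb hc hq0 hq1
  have hdiv := radial_div_nonexpansive ha hb hc
  have hnrm := nrm_sq (x - y)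
  rw [hsSq_sig_sub]
  simp only [inn, bdrift, Pi.sub_apply, hpow _ ha, hpow _ hb] at hmono hgrowth hdiv hnrm ⊢
  rw [ha2, hb2] at hmono hgrowth hdiv
  rw [hnrm]
  generalize nrm x ^ (p / 2 - 1) = A at *
  generalize nrm y ^ (p / 2 - 1) = B at *
  generalize (1 + nrm x)⁻¹ = u at *
  generalize (1 + nrm y)⁻¹ = v at *
  generalize x 0 = x₀ at *
  generalize x 1 = x₁ at *
  generalize y 0 = y₀ at *
  generalize y 1 = y₁ at *
  have hK := mul_le_mul_of_nonneg_right hK₀ (add_nonneg (add_nonneg (sq_nonneg (x₀ - y₀))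
    (sq_nonneg (x₁ - y₁))) hmono)
  linarith [sq_nonneg ((x₀ - y₀) - (A * x₀ - B * y₀)), sq_nonneg ((x₁ - y₁) - (A * x₁ - B * y₁)),
    sq_nonneg (x₀ - y₀), sq_nonneg (x₁ - y₁)]
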